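/- Let X_1, …, X_n be independent random points, each uniformly distributed on the square S_n = [−√n/2, √n/2]². Then the probability that there exist indices i, j with ‖X_i − X_j‖ ≥ √(2n) − 2·√2·log n tends to 1 as n → ∞. -/

import Mathlib

open MeasureTheory Real Filter

/-- The square `S_n = [-√n/2, √n/2]²` in the Euclidean plane. -/
def rggSquare (n : ℕ) : Set (EuclideanSpace ℝ (Fin 2)) :=
  {p | ∀ k, p k ∈ Set.Icc (-(Real.sqrt n / 2)) (Real.sqrt n / 2)}

/-- The uniform probability measure on the square `S_n`. -/
noncomputable def unifSquare (n : ℕ) : Measure (EuclideanSpace ℝ (Fin 2)) :=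
  (volume (rggSquare n))⁻¹ • volume.restrict (rggSquare n)

instance unifSquare_finite (n : ℕ) : IsFiniteMeasure (unifSquare n) := by
  constructor
  rw [unifSquare, Measure.smul_apply, smul_eq_mul, Measure.restrict_apply_univ]
  exact lt_of_le_of_lt (ENNReal.inv_mul_le_one _) ENNReal.one_lt_top

/-- The product measure: `n` independent points uniform on `S_n`. -/
noncomputable def rggMeasure (n : ℕ) : Measure (Fin n → EuclideanSpace ℝ (Fin 2)) :=
  Measure.pi fun _ => unifSquare n

/-- The square `[a, b]²` in the Euclidean plane. -/
def planeSquare (a b : ℝ) : Set (EuclideanSpace ℝ (Fin 2)) :=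
  {p | ∀ k, p k ∈ Set.Icc a b}

theorem planeSquare_eq_preimage (a b : ℝ) :
    planeSquare a b =
      (WithLp.ofLp : EuclideanSpace ℝ (Fin 2) → Fin 2 → ℝ) ⁻¹'
        (Set.univ.pi fun _ => Set.Icc a b) := by
  ext p
  simp only [planeSquare, Set.mem_ofPred_eq, Set.mem_preimage, Set.mem_univ_pi]

theorem measurableSet_planeSquare (a b : ℝ) : MeasurableSet (planeSquare a b) := by
  rw [planeSquare_eq_preimage]
  exact (PiLp.volume_preserving_ofLp (Fin 2)).measurable
    (MeasurableSet.univ_pi fun _ => measurableSet_Icc)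

theorem volume_planeSquare (a b : ℝ) :
    volume (planeSquare a b) = ENNReal.ofReal (b - a) ^ 2 := by
  rw [planeSquare_eq_preimage, (PiLp.volume_preserving_ofLp (Fin 2)).measure_preimage
    (MeasurableSet.univ_pi fun _ => measurableSet_Icc).nullMeasurableSet, volume_pi_pi]
  simp

theorem volume_rggSquare (n : ℕ) : volume (rggSquare n) = n := by
  have h := volume_planeSquare (-(Real.sqrt n / 2)) (Real.sqrt n / 2)
  rw [sub_neg_eq_add, add_halves, ← ENNReal.ofReal_pow (Real.sqrt_nonneg _),
    Real.sq_sqrt (Nat.cast_nonneg n), ENNReal.ofReal_natCast] at h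
  exact h

theorem isProbabilityMeasure_unifSquare {n : ℕ} (hn : n ≠ 0) :
    IsProbabilityMeasure (unifSquare n) := by
  constructor
  rw [unifSquare, Measure.smul_apply, smul_eq_mul, Measure.restrict_apply_univ, volume_rggSquare]
  exact ENNReal.inv_mul_cancel (by exact_mod_cast hn) (ENNReal.natCast_ne_top n)

theorem unifSquare_planeSquare {n : ℕ} (hn : n ≠ 0) {a b : ℝ} (hab : a ≤ b)
    (ha : -(Real.sqrt n / 2) ≤ a) (hb : b ≤ Real.sqrt n / 2) :
    unifSquare n (planeSquare a b) = ENNReal.ofReal ((b - a) ^ 2 / n) := by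
  have hsub : planeSquare a b ⊆ rggSquare n := fun p hp k =>
    Set.Icc_subset_Icc ha hb (hp k)
  rw [unifSquare, Measure.smul_apply, smul_eq_mul,
    Measure.restrict_apply (measurableSet_planeSquare a b), Set.inter_eq_left.mpr hsub,
    volume_planeSquare, volume_rggSquare, ENNReal.ofReal_div_of_pos (by positivity),
    ENNReal.ofReal_natCast, ENNReal.ofReal_pow (sub_nonneg.mpr hab), mul_comm]
  rfl

/-- The probability that none of the `n` points falls into the square `[a, b]² ⊆ S_n` is at most
`exp (-(b - a)²)`. -/
theorem rggMeasure_forall_notMem_le {n : ℕ} (hn : n ≠ 0) {a b : ℝ} (hab : a ≤ b)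
    (ha : -(Real.sqrt n / 2) ≤ a) (hb : b ≤ Real.sqrt n / 2) :
    rggMeasure n (Set.univ.pi fun _ => (planeSquare a b)ᶜ) ≤
      ENNReal.ofReal (Real.exp (-(b - a) ^ 2)) := by
  have := isProbabilityMeasure_unifSquare hn
  rw [rggMeasure, Measure.pi_pi, Finset.prod_const, Finset.card_univ, Fintype.card_fin,
    prob_compl_eq_one_sub (measurableSet_planeSquare a b), unifSquare_planeSquare hn hab ha hb,
    ← ENNReal.ofReal_one, ← ENNReal.ofReal_sub _ (by positivity)]
  have hexp : Real.exp (-(b - a) ^ 2) = Real.exp (-((b - a) ^ 2 / n)) ^ n := by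
    rw [← Real.exp_nat_mul]
    congr 1
    field_simp
  rw [hexp, ENNReal.ofReal_pow (Real.exp_nonneg _)]
  gcongr
  exact Real.one_sub_le_exp_neg _

theorem le_dist_of_mem_planeSquare {s L : ℝ} {p q : EuclideanSpace ℝ (Fin 2)}
    (hp : p ∈ planeSquare (-(s / 2)) (-(s / 2) + L))
    (hq : q ∈ planeSquare (s / 2 - L) (s / 2)) :
    Real.sqrt 2 * (s - 2 * L) ≤ dist p q := by
  rcases le_or_gt (s - 2 * L) 0 with h | h
  · exact (mul_nonpos_of_nonneg_of_nonpos (Real.sqrt_nonneg 2) h).trans dist_nonneg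
  rw [EuclideanSpace.dist_eq, ← Real.sqrt_sq h.le, ← Real.sqrt_mul zero_le_two]
  apply Real.sqrt_le_sqrt
  have hk : ∀ k, (s - 2 * L) ^ 2 ≤ dist (p k) (q k) ^ 2 := fun k => by
    have h₁ := (hp k).2
    have h₂ := (hq k).1
    rw [Real.dist_eq, sq_abs]
    nlinarith
  rw [Fin.sum_univ_two]
  linarith [hk 0, hk 1]

theorem one_sub_le_rggMeasure_exists_far_pair {n : ℕ} (hn : n ≠ 0)
    (hlog : Real.log n ≤ Real.sqrt n) :
    1 - 2 * ENNReal.ofReal (Real.exp (-(Real.log n) ^ 2)) ≤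
      rggMeasure n {X : Fin n → EuclideanSpace ℝ (Fin 2) | ∃ i j : Fin n,
        Real.sqrt (2 * n) - 2 * Real.sqrt 2 * Real.log n ≤ dist (X i) (X j)} := by
  have := isProbabilityMeasure_unifSquare hn
  have : IsProbabilityMeasure (rggMeasure n) := by
    unfold rggMeasure
    infer_instance
  have hlog₀ : 0 ≤ Real.log n := Real.log_natCast_nonneg n
  set s := Real.sqrt n with hs
  set L := Real.log n with hL
  set A := planeSquare (-(s / 2)) (-(s / 2) + L) with hA
  set B := planeSquare (s / 2 - L) (s / 2) with hB
  set U : Set (Fin n → EuclideanSpace ℝ (Fin 2)) := Set.univ.pi fun _ => Aᶜ with hU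
  set V : Set (Fin n → EuclideanSpace ℝ (Fin 2)) := Set.univ.pi fun _ => Bᶜ with hV
  have hUV : MeasurableSet (U ∪ V) :=
    (MeasurableSet.univ_pi fun _ => (measurableSet_planeSquare _ _).compl).union
      (MeasurableSet.univ_pi fun _ => (measurableSet_planeSquare _ _).compl)
  have hUle : rggMeasure n U ≤ ENNReal.ofReal (Real.exp (-L ^ 2)) := by
    have h := rggMeasure_forall_notMem_le hn (a := -(s / 2)) (b := -(s / 2) + L)
      (by linarith) le_rfl (by linarith)
    rwa [add_sub_cancel_left] at h
  have hVle : rggMeasure n V ≤ ENNReal.ofReal (Real.exp (-L ^ 2)) := by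
    have h := rggMeasure_forall_notMem_le hn (a := s / 2 - L) (b := s / 2)
      (by linarith) (by linarith) le_rfl
    rwa [sub_sub_cancel] at h
  calc 1 - 2 * ENNReal.ofReal (Real.exp (-L ^ 2))
      ≤ 1 - rggMeasure n (U ∪ V) := by
        apply tsub_le_tsub_left
        rw [two_mul]
        exact (measure_union_le U V).trans (add_le_add hUle hVle)
    _ = rggMeasure n (U ∪ V)ᶜ := (prob_compl_eq_one_sub hUV).symm
    _ ≤ _ := by
        apply measure_mono
        intro X hX
        simp only [hU, hV, Set.mem_compl_iff, Set.mem_union, Set.mem_univ_pi, not_or, not_forall,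
          not_not] at hX
        obtain ⟨⟨i, hi⟩, j, hj⟩ := hX
        refine ⟨i, j, ?_⟩
        have h := le_dist_of_mem_planeSquare hi hj
        rw [Real.sqrt_mul zero_le_two]
        linarith

/-- A.a.s. there exist two of the `n` uniform random points of `S_n` at Euclidean distance at
least `√(2n) - 2√2 log n`. -/
theorem rgg_exists_far_pair :
    Filter.Tendsto (fun n : ℕ =>
      rggMeasure n {X : Fin n → EuclideanSpace ℝ (Fin 2) | ∃ i j : Fin n,
        Real.sqrt (2 * n) - 2 * Real.sqrt 2 * Real.log n ≤ dist (X i) (X j)})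
      Filter.atTop (nhds 1) := by
  have hlim : Tendsto (fun n : ℕ => 1 - 2 * ENNReal.ofReal (Real.exp (-(Real.log n) ^ 2)))
      atTop (nhds 1) := by
    have h₁ : Tendsto (fun n : ℕ => Real.exp (-(Real.log n) ^ 2)) atTop (nhds 0) :=
      Real.tendsto_exp_neg_atTop_nhds_zero.comp ((tendsto_pow_atTop two_ne_zero).comp
        (Real.tendsto_log_atTop.comp tendsto_natCast_atTop_atTop))
    have h₂ := ENNReal.Tendsto.const_mul (a := 2) (ENNReal.tendsto_ofReal h₁)
      (Or.inr ENNReal.ofNat_ne_top)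
    have h₃ := ENNReal.Tendsto.sub (tendsto_const_nhds (x := (1 : ENNReal))) h₂
      (Or.inl ENNReal.one_ne_top)
    simpa using h₃
  refine tendsto_of_tendsto_of_tendsto_of_le_of_le' hlim tendsto_const_nhds ?_ ?_
  · have hlog : ∀ᶠ n : ℕ in atTop, Real.log n ≤ Real.sqrt n := by
      have h := ((isLittleO_log_rpow_atTop (r := 1 / 2) (by norm_num)).bound one_pos)
      filter_upwards [tendsto_natCast_atTop_atTop.eventually h] with n hn
      rw [one_mul, ← Real.sqrt_eq_rpow, Real.norm_of_nonneg (Real.sqrt_nonneg _)] at hn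
      exact (le_abs_self _).trans hn
    filter_upwards [hlog, eventually_ne_atTop 0] with n hn hn₀
    exact one_sub_le_rggMeasure_exists_far_pair hn₀ hn
  · filter_upwards [eventually_ne_atTop 0] with n hn
    have := isProbabilityMeasure_unifSquare hn
    unfold rggMeasure
    exact prob_le_one
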